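/- If n is sufficiently large, 0 < ε < 1/2, and G is a properly edge-coloured n-vertex graph with at least (4/ε)·n·log n edges, then there exists a positive integer k such that G contains a cycle of length k whose edges have more than (1-ε)·k distinct colours. -/

import Mathlib

open SimpleGraph

/-- An edge-colouring `c` of (the edges of) `G` is proper if any two distinct edges
sharing a vertex receive different colours. -/
def IsProperEdgeColoring {V β : Type} (G : SimpleGraph V) (c : Sym2 V → β) : Prop :=
  ∀ ⦃e₁ e₂ : Sym2 V⦄, e₁ ∈ G.edgeSet → e₂ ∈ G.edgeSet → e₁ ≠ e₂ →
    (∃ v, v ∈ e₁ ∧ v ∈ e₂) → c e₁ ≠ c e₂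

theorem Matrix.list_ofFn_prod_apply {V R : Type*} [Fintype V] [DecidableEq V] [CommSemiring R]
    {m : ℕ} (B : Fin m → Matrix V V R) (u v : V) :
    (List.ofFn B).prod u v = ∑ x : Fin (m + 1) → V,
      if x 0 = u ∧ x (Fin.last m) = v then ∏ i, B i (x i.castSucc) (x i.succ) else 0 := by
  induction m generalizing u with
  | zero =>
    rw [← (Equiv.funUnique (Fin 1) V).symm.sum_comp]
    simp [Matrix.one_apply, ite_and]
  | succ m ih =>
    rw [List.ofFn_succ, List.prod_cons, Matrix.mul_apply,
      ← (Fin.consEquiv fun _ : Fin (m + 2) => V).sum_comp, Fintype.sum_prod_type]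
    simp_rw [ih, Finset.mul_sum]
    rw [Finset.sum_comm, Finset.sum_comm (γ := V)]
    refine Finset.sum_congr rfl fun x _ => ?_
    simp [Fin.prod_univ_succ, ite_and, ← Fin.succ_last, Fin.consEquiv]

theorem Matrix.trace_list_ofFn_prod {V R : Type*} [Fintype V] [DecidableEq V] [CommSemiring R]
    {m : ℕ} (B : Fin m → Matrix V V R) :
    (List.ofFn B).prod.trace = ∑ x : Fin (m + 1) → V,
      if x 0 = x (Fin.last m) then ∏ i, B i (x i.castSucc) (x i.succ) else 0 := by
  simp_rw [Matrix.trace, Matrix.diag, Matrix.list_ofFn_prod_apply]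
  rw [Finset.sum_comm]
  refine Finset.sum_congr rfl fun x _ => ?_
  simp [ite_and, eq_comm]

theorem List.ofFn_ite_two_eq {α : Type*} (M N : α) {m : ℕ} {i j : Fin m} (hij : i < j) :
    List.ofFn (fun l : Fin m => if l = i ∨ l = j then M else N) =
      List.replicate i N ++ M :: (List.replicate (j - i - 1) N ++
        M :: List.replicate (m - 1 - j) N) := by
  apply List.ext_getElem
  · simp; omega
  · intro l h₁ h₂
    simp only [List.getElem_ofFn, List.getElem_append, List.getElem_cons, List.getElem_replicate,
      List.length_replicate, Fin.ext_iff]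
    split_ifs <;> first | rfl | omega

theorem Matrix.IsHermitian.trace_mul_pow_mul_mul_pow_le {V : Type*} [Fintype V] [DecidableEq V]
    {M N : Matrix V V ℝ} (hM : M.IsHermitian) (hN : N.IsHermitian) {a b k : ℕ}
    (hab : a + b = 2 * k) :
    (M * N ^ a * M * N ^ b).trace ≤ (M * M * N ^ (2 * k)).trace := by
  set l := hN.eigenvalues
  obtain ⟨U, hU, hU', hspec⟩ : ∃ U : Matrix V V ℝ, star U * U = 1 ∧ U * star U = 1 ∧
      N = U * Matrix.diagonal l * star U := by
    refine ⟨hN.eigenvectorUnitary, ?_, ?_, ?_⟩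
    · simp
    · simp
    · have := hN.spectral_theorem
      rw [Unitary.conjStarAlgAut_apply] at this
      exact this
  have hpow (r : ℕ) : N ^ r = U * Matrix.diagonal (fun p => l p ^ r) * star U := by
    induction r with
    | zero => simp [hU']
    | succ r ih =>
      rw [pow_succ, ih, hspec]
      calc _ = U * Matrix.diagonal (fun p => l p ^ r) * (star U * U) * Matrix.diagonal l * star U := by
            simp only [Matrix.mul_assoc]
        _ = _ := by
            rw [hU, Matrix.mul_one, Matrix.mul_assoc U, Matrix.diagonal_mul_diagonal]
            simp [pow_succ]
  set P := star U * M * U with hP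
  have hPs (p q : V) : P q p = P p q := by
    have : P.IsHermitian := by
      rw [hP, Matrix.star_eq_conjTranspose]
      exact Matrix.isHermitian_conjTranspose_mul_mul _ hM
    simpa using this.apply p q
  have key (a b : ℕ) : (M * N ^ a * M * N ^ b).trace = ∑ p, ∑ q, P p q ^ 2 * (l q ^ a * l p ^ b) := by
    have : (M * N ^ a * M * N ^ b).trace =
        (P * Matrix.diagonal (fun p => l p ^ a) * P * Matrix.diagonal (fun p => l p ^ b)).trace := by
      rw [hpow, hpow, hP, ← Matrix.mul_assoc, Matrix.trace_mul_comm]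
      simp only [Matrix.mul_assoc]
    rw [this]
    refine Finset.sum_congr rfl fun p _ => ?_
    rw [Matrix.diag_apply, Matrix.mul_diagonal, Matrix.mul_apply, Finset.sum_mul]
    refine Finset.sum_congr rfl fun q _ => ?_
    rw [Matrix.mul_diagonal, hPs p q]; ring
  have h0 : (M * M * N ^ (2 * k)).trace = ∑ p, ∑ q, P p q ^ 2 * l p ^ (2 * k) := by
    simpa using key 0 (2 * k)
  have h0' : (M * M * N ^ (2 * k)).trace = ∑ p, ∑ q, P p q ^ 2 * l q ^ (2 * k) := by
    rw [h0, Finset.sum_comm]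
    simp_rw [hPs]
  have hs : (M * N ^ a * M * N ^ b).trace = ∑ p, ∑ q, P p q ^ 2 * (l p ^ a * l q ^ b) := by
    rw [key, Finset.sum_comm]
    simp_rw [hPs]
  suffices (M * N ^ a * M * N ^ b).trace + (M * N ^ a * M * N ^ b).trace ≤
      (M * M * N ^ (2 * k)).trace + (M * M * N ^ (2 * k)).trace by linarith
  nth_rw 1 [key, hs, h0, h0']
  simp_rw [← Finset.sum_add_distrib, ← mul_add]
  refine Finset.sum_le_sum fun p _ => Finset.sum_le_sum fun q _ =>
    mul_le_mul_of_nonneg_left ?_ (sq_nonneg _)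
  have habs (x : ℝ) : x ^ (2 * k) = |x| ^ a * |x| ^ b := by
    rw [← pow_add, hab, (even_two_mul k).pow_abs]
  have h1 : l q ^ a * l p ^ b ≤ |l q| ^ a * |l p| ^ b := by
    rw [← abs_pow, ← abs_pow, ← abs_mul]; exact le_abs_self _
  have h2 : l p ^ a * l q ^ b ≤ |l p| ^ a * |l q| ^ b := by
    rw [← abs_pow, ← abs_pow, ← abs_mul]; exact le_abs_self _
  rw [habs, habs]
  rcases le_total |l p| |l q| with h | h
  · have := pow_le_pow_left₀ (abs_nonneg _) h a
    have := pow_le_pow_left₀ (abs_nonneg _) h b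
    nlinarith
  · have := pow_le_pow_left₀ (abs_nonneg _) h a
    have := pow_le_pow_left₀ (abs_nonneg _) h b
    nlinarith

theorem Fintype.card_le_card_image_add_card_pairs {β : Type*} [DecidableEq β] {m : ℕ}
    (f : Fin m → β) :
    m ≤ (Finset.univ.image f).card +
      (Finset.univ.filter fun p : Fin m × Fin m => p.1 < p.2 ∧ f p.1 = f p.2).card := by
  classical
  set P := Finset.univ.filter fun p : Fin m × Fin m => p.1 < p.2 ∧ f p.1 = f p.2 with hP
  have h1 : (Finset.univ \ P.image Prod.snd).card ≤ (Finset.univ.image f).card := by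
    refine Finset.card_le_card_of_injOn f (fun i _ => by simp) fun i hi j hj hij => ?_
    simp only [hP, Finset.coe_sdiff, Set.mem_sdiff, Finset.mem_coe, Finset.mem_image,
      Finset.mem_filter, Finset.mem_univ, true_and, Prod.exists, not_exists, not_and] at hi hj
    rcases lt_trichotomy i j with h | h | h
    · exact absurd rfl (hj i j ⟨h, hij⟩)
    · exact h
    · exact absurd rfl (hi j i ⟨h, hij.symm⟩)
  have h2 := Finset.card_sdiff_add_card_eq_card (Finset.subset_univ (P.image Prod.snd))
  have h3 : (P.image Prod.snd).card ≤ P.card := Finset.card_image_le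
  rw [Finset.card_univ, Fintype.card_fin] at h2
  omega

theorem Fin.card_filter_fst_lt_snd (m : ℕ) :
    (Finset.univ.filter fun p : Fin m × Fin m => p.1 < p.2).card * 2 = m * (m - 1) := by
  rw [← Finset.sum_range_id_mul_two, ← Fin.sum_univ_eq_sum_range (fun i => i)]
  congr 1
  rw [Finset.card_filter, Fintype.sum_prod_type_right]
  refine Finset.sum_congr rfl fun j _ => ?_
  rw [← Finset.card_filter, ← Fin.card_Iio j]
  congr 1; ext; simp

namespace SimpleGraph

variable {V : Type*} {G : SimpleGraph V}

theorem Walk.exists_edges_eq_ofFn {m : ℕ} (x : Fin (m + 1) → V)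
    (hx : ∀ i : Fin m, G.Adj (x i.castSucc) (x i.succ)) :
    ∃ w : G.Walk (x 0) (x (Fin.last m)),
      w.edges = List.ofFn fun i : Fin m => s(x i.castSucc, x i.succ) := by
  induction m with
  | zero => exact ⟨Walk.nil, by simp⟩
  | succ m ih =>
    obtain ⟨w, hw⟩ := ih (fun i => x i.succ) fun i => hx i.succ
    exact ⟨Walk.cons (hx 0) w, (congrArg _ hw).trans
      (List.ofFn_succ (f := fun i => s(x i.castSucc, x i.succ))).symm⟩

theorem Walk.exists_isPath_card_sdiff_le {β : Type*} [DecidableEq V] [DecidableEq β]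
    (c : Sym2 V → β) {t : ℝ} (ht : 1 / 2 ≤ t)
    (hcyc : ∀ (v : V) (w : G.Walk v v), w.IsCycle →
      ((w.edges.map c).toFinset.card : ℝ) ≤ t * w.length)
    {u v : V} (p : G.Walk u v) :
    ∃ q : G.Walk u v, q.IsPath ∧
      (((p.edges.map c).toFinset \ (q.edges.map c).toFinset).card : ℝ) ≤
        t * (p.length - q.length) := by
  induction p with
  | nil => exact ⟨Walk.nil, by simp, by simp⟩
  | @cons u y v h p ih =>
    obtain ⟨q, hq, hle⟩ := ih
    by_cases hu : u ∈ q.support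
    · refine ⟨q.dropUntil u hu, hq.dropUntil hu, ?_⟩
      have hp₁ := hq.takeUntil hu
      have hspec := q.take_spec hu
      set q₁ := q.takeUntil u hu
      set q₂ := q.dropUntil u hu
      have hlen : (q.length : ℝ) = q₁.length + q₂.length := by
        rw [← hspec, Walk.length_append]; push_cast; rfl
      have hclosed : ((((Walk.cons h q₁).edges.map c).toFinset).card : ℝ) ≤
          t * (q₁.length + 1) := by
        by_cases he : s(u, y) ∈ q₁.edges
        · have h1 := hp₁.length_eq_one_of_mem_edges (Sym2.eq_swap ▸ he)
          have h2 : ((Walk.cons h q₁).edges.map c).toFinset ⊆ {c s(u, y)} := by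
            obtain ⟨e, he'⟩ := List.length_eq_one_iff.1 (q₁.length_edges.trans h1)
            rw [he', List.mem_singleton] at he
            simp [he', he]
          have h3 := Finset.card_le_card h2
          rw [Finset.card_singleton] at h3
          have h4 : ((((Walk.cons h q₁).edges.map c).toFinset).card : ℝ) ≤ 1 := by
            exact_mod_cast h3
          rw [h1]; push_cast; linarith
        · have := hcyc u _ ((Walk.cons_isCycle_iff q₁ h).2 ⟨hp₁, he⟩)
          rwa [Walk.length_cons, Nat.cast_add, Nat.cast_one] at this
      have hsub : ((Walk.cons h p).edges.map c).toFinset \ (q₂.edges.map c).toFinset ⊆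
          ((p.edges.map c).toFinset \ (q.edges.map c).toFinset) ∪
            ((Walk.cons h q₁).edges.map c).toFinset := by
        intro b
        rw [← hspec]
        simp only [Walk.edges_cons, Walk.edges_append, List.map_cons, List.map_append,
          Finset.mem_sdiff, Finset.mem_union, List.mem_toFinset, List.mem_cons, List.mem_append]
        tauto
      have hcard : ((((Walk.cons h p).edges.map c).toFinset \ (q₂.edges.map c).toFinset).card : ℝ) ≤
          ((p.edges.map c).toFinset \ (q.edges.map c).toFinset).card +
            (((Walk.cons h q₁).edges.map c).toFinset).card := by
        exact_mod_cast (Finset.card_le_card hsub).trans (Finset.card_union_le _ _)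
      rw [Walk.length_cons, Nat.cast_add, Nat.cast_one]
      have hmul : t * (p.length - q.length) + t * (q₁.length + 1) =
          t * (p.length + 1 - q₂.length) := by
        rw [hlen]; ring
      linarith
    · refine ⟨Walk.cons h q, (Walk.cons_isPath_iff h q).2 ⟨hq, hu⟩, ?_⟩
      have hsub : ((Walk.cons h p).edges.map c).toFinset \
          ((Walk.cons h q).edges.map c).toFinset ⊆
          (p.edges.map c).toFinset \ (q.edges.map c).toFinset := by
        intro b
        simp only [Walk.edges_cons, List.map_cons, Finset.mem_sdiff, List.mem_toFinset,
          List.mem_cons]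
        tauto
      refine (Nat.cast_le.2 (Finset.card_le_card hsub)).trans (hle.trans_eq ?_)
      simp

theorem Walk.card_colors_le_of_forall_isCycle {β : Type*} [DecidableEq V] [DecidableEq β]
    (c : Sym2 V → β) {t : ℝ} (ht : 1 / 2 ≤ t)
    (hcyc : ∀ (v : V) (w : G.Walk v v), w.IsCycle →
      ((w.edges.map c).toFinset.card : ℝ) ≤ t * w.length)
    {v : V} (w : G.Walk v v) : ((w.edges.map c).toFinset.card : ℝ) ≤ t * w.length := by
  obtain ⟨q, hq, hle⟩ := w.exists_isPath_card_sdiff_le c ht hcyc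
  simpa [(Walk.isPath_iff_nil.1 hq).eq_nil] using hle

/-- Average degree at least `2 * d` forces a nonempty induced subgraph of minimum degree
at least `d`. -/
theorem exists_nonempty_forall_le_card_filter [Fintype V] [Nonempty V] [DecidableEq V]
    [DecidableRel G.Adj] {d : ℝ} (hd : d * Fintype.card V ≤ G.edgeFinset.card) :
    ∃ S : Finset V, S.Nonempty ∧ ∀ v ∈ S, d ≤ (S.filter (G.Adj v)).card := by
  classical
  set f : Finset V → ℝ := fun S => ∑ u ∈ S, ((S.filter (G.Adj u)).card : ℝ) with hf
  have huniv : 2 * d * (Finset.univ : Finset V).card ≤ f Finset.univ := by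
    have : f Finset.univ = 2 * G.edgeFinset.card := by
      have := G.sum_degrees_eq_twice_card_edges
      simp only [hf]
      simp only [← card_neighborFinset_eq_degree, neighborFinset_eq_filter] at this
      exact_mod_cast this
    rw [this, Finset.card_univ]; linarith
  obtain ⟨S, -, hS⟩ := (Set.toFinite
    {S : Finset V | S.Nonempty ∧ 2 * d * S.card ≤ f S}).exists_le_minimal (a := Finset.univ) ⟨Finset.univ_nonempty, huniv⟩
  refine ⟨S, hS.prop.1, fun v hv => ?_⟩
  by_contra! hlt
  have herase : f S = f (S.erase v) + 2 * (S.filter (G.Adj v)).card := by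
    have h1 : ∀ T : Finset V, f T = ∑ u ∈ T, ∑ w ∈ T, if G.Adj u w then (1 : ℝ) else 0 := by
      intro T; simp [hf]
    have h2 : ((S.filter (G.Adj v)).card : ℝ) =
        ∑ w ∈ S.erase v, if G.Adj v w then (1 : ℝ) else 0 := by
      have := Finset.add_sum_erase S (fun w => if G.Adj v w then (1 : ℝ) else 0) hv
      simp only [G.irrefl, if_false, zero_add] at this
      rw [this]; simp
    have h3 := h2
    simp_rw [G.adj_comm v] at h3
    have h4 : ((S.filter (G.Adj v)).card : ℝ) = ∑ w ∈ S, if G.Adj v w then (1 : ℝ) else 0 := by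
      simp
    rw [h1, h1, ← Finset.add_sum_erase S _ hv]
    simp_rw [← Finset.add_sum_erase S (fun w => if G.Adj _ w then (1 : ℝ) else 0) hv]
    rw [Finset.sum_add_distrib, ← h3, ← h2]
    simp [G.adj_comm]
    ring
  have hne : (S.erase v).Nonempty := by
    by_contra hemp
    rw [Finset.not_nonempty_iff_eq_empty] at hemp
    have h1 := hS.prop.2
    rw [herase, hemp] at h1
    have h2 : S.card = 1 := by
      have := Finset.card_erase_add_one hv
      rw [hemp] at this; simpa using this.symm
    simp only [h2, hf] at h1
    simp at h1
    linarith
  have hmem : 2 * d * (S.erase v).card ≤ f (S.erase v) := by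
    have h1 := hS.prop.2
    have h2 : ((S.erase v).card : ℝ) + 1 = S.card := by
      exact_mod_cast Finset.card_erase_add_one hv
    rw [← h2, herase] at h1
    linarith
  have := hS.le_of_le ⟨hne, hmem⟩ (Finset.erase_subset v S)
  exact absurd (this hv) (Finset.notMem_erase v S)

section NormalizedAdjMatrix

variable {V : Type*} [Fintype V] (H : SimpleGraph V) [DecidableRel H.Adj]

/-- The symmetrically normalized adjacency matrix `D ^ (-1/2) * A * D ^ (-1/2)`. -/
noncomputable def normalizedAdjMatrix : Matrix V V ℝ :=
  Matrix.of fun u v => if H.Adj u v then (√(H.degree u * H.degree v : ℝ))⁻¹ else 0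

theorem normalizedAdjMatrix_apply (u v : V) : H.normalizedAdjMatrix u v =
    if H.Adj u v then (√(H.degree u * H.degree v : ℝ))⁻¹ else 0 := rfl

theorem normalizedAdjMatrix_comm (u v : V) :
    H.normalizedAdjMatrix u v = H.normalizedAdjMatrix v u := by
  simp only [normalizedAdjMatrix_apply, H.adj_comm u v, mul_comm]

theorem isHermitian_normalizedAdjMatrix : H.normalizedAdjMatrix.IsHermitian :=
  Matrix.IsHermitian.ext fun u v => H.normalizedAdjMatrix_comm v u

theorem normalizedAdjMatrix_nonneg (u v : V) : 0 ≤ H.normalizedAdjMatrix u v := by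
  rw [normalizedAdjMatrix_apply]; split_ifs <;> positivity

theorem sum_normalizedAdjMatrix_sq_le {d : ℝ} (hd : 0 < d)
    (hdeg : ∀ u v, H.Adj u v → d ≤ H.degree u) (u : V) :
    ∑ v, H.normalizedAdjMatrix u v ^ 2 ≤ d⁻¹ := by
  have h (v : V) : H.normalizedAdjMatrix u v ^ 2 ≤
      if H.Adj u v then (H.degree u : ℝ)⁻¹ * d⁻¹ else 0 := by
    rw [normalizedAdjMatrix_apply]
    split_ifs with huv
    · rw [inv_pow, Real.sq_sqrt (by positivity), mul_inv]
      gcongr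
      exact hdeg v u huv.symm
    · simp
  refine (Finset.sum_le_sum fun v _ => h v).trans ?_
  rw [← Finset.sum_filter, Finset.sum_const, ← neighborFinset_eq_filter,
    card_neighborFinset_eq_degree, nsmul_eq_mul, ← mul_assoc]
  exact mul_le_of_le_one_left (by positivity) mul_inv_le_one

theorem normalizedAdjMatrix_mulVec_sqrt_degree :
    H.normalizedAdjMatrix.mulVec (fun v => √(H.degree v)) = fun v => √(H.degree v) := by
  ext u
  have h (v : V) : H.normalizedAdjMatrix u v * √(H.degree v) =
      if H.Adj u v then (√(H.degree u))⁻¹ else 0 := by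
    rw [normalizedAdjMatrix_apply]
    split_ifs with huv
    · have hv : 0 < H.degree v := (H.degree_pos_iff_exists_adj v).2 ⟨u, huv.symm⟩
      have : √(H.degree v : ℝ) ≠ 0 := by positivity
      rw [Real.sqrt_mul (by positivity), mul_inv, mul_assoc, inv_mul_cancel₀ this, mul_one]
    · simp
  simp only [Matrix.mulVec, dotProduct, h]
  rw [← Finset.sum_filter, Finset.sum_const, ← neighborFinset_eq_filter,
    card_neighborFinset_eq_degree, nsmul_eq_mul, ← div_eq_mul_inv, Real.div_sqrt]

variable [DecidableEq V]

theorem normalizedAdjMatrix_pow_nonneg (r : ℕ) (u v : V) :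
    0 ≤ (H.normalizedAdjMatrix ^ r) u v := by
  induction r generalizing v with
  | zero => rw [pow_zero, Matrix.one_apply]; split_ifs <;> simp
  | succ r ih =>
    rw [pow_succ, Matrix.mul_apply]
    exact Finset.sum_nonneg fun y _ => mul_nonneg (ih y) (H.normalizedAdjMatrix_nonneg y v)

theorem one_le_trace_normalizedAdjMatrix_pow {u v : V} (huv : H.Adj u v) (k : ℕ) :
    1 ≤ (H.normalizedAdjMatrix ^ (2 * k)).trace := by
  set w : V → ℝ := fun v => √(H.degree v) with hw
  have hPw (k : ℕ) : (H.normalizedAdjMatrix ^ k).mulVec w = w := by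
    induction k with
    | zero => simp
    | succ k ih =>
      rw [pow_succ, ← Matrix.mulVec_mulVec, hw, normalizedAdjMatrix_mulVec_sqrt_degree]
      exact ih
  set P := H.normalizedAdjMatrix ^ k with hP
  have hPs (x y : V) : P x y = P y x := by
    simpa using (H.isHermitian_normalizedAdjMatrix.pow k).apply y x
  have htr : (H.normalizedAdjMatrix ^ (2 * k)).trace = ∑ x, ∑ y, P x y ^ 2 := by
    rw [two_mul, pow_add, ← hP]
    simp only [Matrix.trace, Matrix.diag_apply, Matrix.mul_apply]
    refine Finset.sum_congr rfl fun x _ => Finset.sum_congr rfl fun y _ => ?_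
    rw [hPs y x, sq]
  have hpos : 0 < ∑ x, w x ^ 2 := by
    have hu : 0 < H.degree u := (H.degree_pos_iff_exists_adj u).2 ⟨v, huv⟩
    refine Finset.sum_pos' (fun x _ => sq_nonneg _) ⟨u, Finset.mem_univ u, ?_⟩
    have : 0 < w u := Real.sqrt_pos.2 (by exact_mod_cast hu)
    positivity
  have hle : ∑ x, w x ^ 2 ≤ (∑ x, ∑ y, P x y ^ 2) * ∑ x, w x ^ 2 := by
    rw [Finset.sum_mul]
    refine Finset.sum_le_sum fun x _ => ?_
    have := congrFun (hPw k) x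
    rw [← this]
    exact Finset.sum_mul_sq_le_sq_mul_sq _ _ _
  rw [htr]
  exact le_of_mul_le_mul_right (by simpa using hle) hpos

end NormalizedAdjMatrix

section ClosedWalks

variable {V β : Type} [Fintype V] [DecidableEq β] (H : SimpleGraph V) [DecidableRel H.Adj]

/-- The part of the normalized adjacency matrix supported on the edges of colour `b`. -/
noncomputable def colorMatrix (c : Sym2 V → β) (b : β) : Matrix V V ℝ :=
  Matrix.of fun u v => if c s(u, v) = b then H.normalizedAdjMatrix u v else 0

theorem colorMatrix_apply (c : Sym2 V → β) (b : β) (u v : V) :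
    H.colorMatrix c b u v = if c s(u, v) = b then H.normalizedAdjMatrix u v else 0 := rfl

theorem isHermitian_colorMatrix (c : Sym2 V → β) (b : β) : (H.colorMatrix c b).IsHermitian :=
  Matrix.IsHermitian.ext fun u v => by
    simp only [colorMatrix_apply, Sym2.eq_swap (a := u), H.normalizedAdjMatrix_comm u, star_trivial]

theorem colorMatrix_nonneg (c : Sym2 V → β) (b : β) (u v : V) : 0 ≤ H.colorMatrix c b u v := by
  rw [colorMatrix_apply]
  split_ifs
  · exact H.normalizedAdjMatrix_nonneg u v
  · exact le_rfl

variable [DecidableEq V]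

/-- The weight of a sequence of vertices as a closed walk, with respect to the normalized
adjacency matrix. It vanishes if the sequence is not a closed walk. -/
noncomputable def closedWalkWeight {m : ℕ} (x : Fin (m + 1) → V) : ℝ :=
  if x 0 = x (Fin.last m) then ∏ i : Fin m, H.normalizedAdjMatrix (x i.castSucc) (x i.succ) else 0

theorem closedWalkWeight_nonneg {m : ℕ} (x : Fin (m + 1) → V) : 0 ≤ H.closedWalkWeight x := by
  unfold closedWalkWeight
  split_ifs
  · exact Finset.prod_nonneg fun i _ => H.normalizedAdjMatrix_nonneg _ _
  · exact le_rfl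

theorem sum_closedWalkWeight (m : ℕ) :
    ∑ x : Fin (m + 1) → V, H.closedWalkWeight x = (H.normalizedAdjMatrix ^ m).trace := by
  rw [← List.prod_replicate, ← List.ofFn_const, Matrix.trace_list_ofFn_prod]
  rfl

theorem sum_colorMatrix_mul_self {c : Sym2 V → β} (hc : IsProperEdgeColoring H c) :
    ∑ b ∈ Finset.univ.image c, H.colorMatrix c b * H.colorMatrix c b =
      Matrix.diagonal fun u => ∑ v, H.normalizedAdjMatrix u v ^ 2 := by
  ext u v
  have h (y : V) : ∑ b ∈ Finset.univ.image c, H.colorMatrix c b u y * H.colorMatrix c b y v =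
      if u = v then H.normalizedAdjMatrix u y ^ 2 else 0 := by
    have h1 : ∑ b ∈ Finset.univ.image c, H.colorMatrix c b u y * H.colorMatrix c b y v =
        H.normalizedAdjMatrix u y * H.colorMatrix c (c s(u, y)) y v := by
      rw [Finset.sum_eq_single (c s(u, y))]
      · rw [colorMatrix_apply, if_pos rfl]
      · intro b _ hb
        rw [colorMatrix_apply, if_neg hb.symm, zero_mul]
      · intro hn
        exact absurd (Finset.mem_image_of_mem c (Finset.mem_univ _)) hn
    rw [h1, colorMatrix_apply]
    split_ifs with h2 h3 h3
    · rw [h3, sq, H.normalizedAdjMatrix_comm y v]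
    · rw [normalizedAdjMatrix_apply, normalizedAdjMatrix_apply]
      split_ifs with h4 h5
      · refine absurd h2.symm (hc (e₁ := s(u, y)) (e₂ := s(y, v)) h4 h5 ?_ ⟨y, by simp, by simp⟩)
        intro he
        rw [Sym2.eq_swap] at he
        exact h3 (Sym2.congr_right.1 he)
      all_goals simp
    · exact absurd (by rw [h3, Sym2.eq_swap]) h2
    · rw [mul_zero]
  rw [Matrix.sum_apply, Matrix.diagonal_apply]
  simp only [Matrix.mul_apply]
  rw [Finset.sum_comm, Finset.sum_congr rfl fun y _ => h y]
  split_ifs <;> simp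

theorem sum_closedWalkWeight_filter_le {c : Sym2 V → β} (hc : IsProperEdgeColoring H c) {d : ℝ}
    (hd : 0 < d) (hdeg : ∀ u v, H.Adj u v → d ≤ H.degree u) {k : ℕ} {i j : Fin (2 * k + 2)}
    (hij : i < j) :
    ∑ x : Fin (2 * k + 2 + 1) → V with
        c s(x i.castSucc, x i.succ) = c s(x j.castSucc, x j.succ), H.closedWalkWeight x ≤
      d⁻¹ * (H.normalizedAdjMatrix ^ (2 * k)).trace := by
  set N := H.normalizedAdjMatrix
  set M := H.colorMatrix c
  set C := Finset.univ.image c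
  let B (b : β) (l : Fin (2 * k + 2)) : Matrix V V ℝ := if l = i ∨ l = j then M b else N
  have hB (b : β) (l : Fin (2 * k + 2)) (u v : V) : 0 ≤ B b l u v := by
    simp only [B]
    split_ifs
    · exact H.colorMatrix_nonneg c b u v
    · exact H.normalizedAdjMatrix_nonneg u v
  have hterm (b : β) (x : Fin (2 * k + 2 + 1) → V) :
      0 ≤ if x 0 = x (Fin.last _) then ∏ l, B b l (x l.castSucc) (x l.succ) else 0 := by
    split_ifs
    · exact Finset.prod_nonneg fun l _ => hB b l _ _
    · exact le_rfl
  calc _ ≤ ∑ x : Fin (2 * k + 2 + 1) → V, ∑ b ∈ C,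
        if x 0 = x (Fin.last _) then ∏ l, B b l (x l.castSucc) (x l.succ) else 0 := by
        rw [Finset.sum_filter]
        refine Finset.sum_le_sum fun x _ => ?_
        by_cases hx : c s(x i.castSucc, x i.succ) = c s(x j.castSucc, x j.succ)
        · rw [if_pos hx]
          refine le_trans (le_of_eq ?_) (Finset.single_le_sum (fun b _ => hterm b x)
            (Finset.mem_image_of_mem c (Finset.mem_univ s(x i.castSucc, x i.succ))))
          unfold closedWalkWeight
          congr 1
          refine Finset.prod_congr rfl fun l _ => ?_
          simp only [B]
          split_ifs with hl
          · rcases hl with rfl | rfl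
            · exact (if_pos rfl).symm
            · exact (if_pos hx.symm).symm
          · rfl
        · rw [if_neg hx]
          exact Finset.sum_nonneg fun b _ => hterm b x
    _ = ∑ b ∈ C, (List.ofFn (B b)).prod.trace := by
        rw [Finset.sum_comm]
        exact Finset.sum_congr rfl fun b _ => (Matrix.trace_list_ofFn_prod (B b)).symm
    _ ≤ ∑ b ∈ C, (M b * M b * N ^ (2 * k)).trace := by
        refine Finset.sum_le_sum fun b _ => ?_
        have h1 : (List.ofFn (B b)).prod.trace =
            (M b * N ^ (j.val - i - 1) * M b * N ^ (2 * k + 2 - 1 - j + i)).trace := by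
          simp only [B]
          rw [List.ofFn_ite_two_eq _ _ hij, pow_add]
          simp only [List.prod_append, List.prod_cons, List.prod_replicate]
          rw [Matrix.trace_mul_comm]
          simp only [Matrix.mul_assoc]
        rw [h1]
        refine (H.isHermitian_colorMatrix c b).trace_mul_pow_mul_mul_pow_le
          H.isHermitian_normalizedAdjMatrix ?_
        omega
    _ = ((Matrix.diagonal fun u => ∑ v, N u v ^ 2) * N ^ (2 * k)).trace := by
        rw [← H.sum_colorMatrix_mul_self hc, Finset.sum_mul, Matrix.trace_sum]
    _ ≤ d⁻¹ * (N ^ (2 * k)).trace := by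
        simp only [Matrix.trace, Matrix.diag_apply, Matrix.diagonal_mul]
        rw [Finset.mul_sum]
        exact Finset.sum_le_sum fun u _ => mul_le_mul_of_nonneg_right
          (H.sum_normalizedAdjMatrix_sq_le hd hdeg u) (H.normalizedAdjMatrix_pow_nonneg _ u u)

theorem trace_le_of_forall_card_colors_le {c : Sym2 V → β} (hc : IsProperEdgeColoring H c)
    {d : ℝ} (hd : 0 < d) (hdeg : ∀ u v, H.Adj u v → d ≤ H.degree u) {ε : ℝ} {k : ℕ}
    (hcol : ∀ (v : V) (w : H.Walk v v),
      ((w.edges.map c).toFinset.card : ℝ) ≤ (1 - ε) * w.length) :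
    2 * ε * d * (H.normalizedAdjMatrix ^ (2 * k + 2)).trace ≤
      (2 * k + 1) * (H.normalizedAdjMatrix ^ (2 * k)).trace := by
  set m := 2 * k + 2 with hm
  let e (x : Fin (m + 1) → V) (i : Fin m) : Sym2 V := s(x i.castSucc, x i.succ)
  have hwalk (x : Fin (m + 1) → V) : ε * m * H.closedWalkWeight x ≤
      ((Finset.univ.filter fun p : Fin m × Fin m => p.1 < p.2 ∧ c (e x p.1) = c (e x p.2)).card : ℝ)
        * H.closedWalkWeight x := by
    by_cases h0 : H.closedWalkWeight x = 0
    · simp [h0]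
    refine mul_le_mul_of_nonneg_right ?_ (H.closedWalkWeight_nonneg x)
    have hclosed : x 0 = x (Fin.last m) := by
      by_contra hne
      exact h0 (if_neg hne)
    have hadj (i : Fin m) : H.Adj (x i.castSucc) (x i.succ) := by
      by_contra hne
      refine h0 ((if_pos hclosed).trans (Finset.prod_eq_zero (Finset.mem_univ i) ?_))
      rw [normalizedAdjMatrix_apply, if_neg hne]
    obtain ⟨w, hw⟩ := Walk.exists_edges_eq_ofFn x hadj
    have h1 := hcol _ (w.copy rfl hclosed.symm)
    have hlen : w.length = m := by rw [← w.length_edges, hw, List.length_ofFn]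
    have himg : (w.edges.map c).toFinset = Finset.univ.image fun i => c (e x i) := by
      ext b
      simp only [hw, e, List.mem_toFinset, List.mem_map, List.mem_ofFn, Finset.mem_image,
        Finset.mem_univ, true_and, exists_exists_eq_and]
    rw [Walk.edges_copy, Walk.length_copy, himg, hlen] at h1
    have h2 := Fintype.card_le_card_image_add_card_pairs fun i => c (e x i)
    have h3 : (m : ℝ) ≤ (Finset.univ.image fun i => c (e x i)).card +
        (Finset.univ.filter fun p : Fin m × Fin m =>
          p.1 < p.2 ∧ c (e x p.1) = c (e x p.2)).card := by exact_mod_cast h2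
    linarith
  have hsum : ε * m * (H.normalizedAdjMatrix ^ m).trace ≤
      ∑ p : Fin m × Fin m with p.1 < p.2, d⁻¹ * (H.normalizedAdjMatrix ^ (2 * k)).trace := by
    calc _ ≤ ∑ x : Fin (m + 1) → V, ((Finset.univ.filter fun p : Fin m × Fin m =>
            p.1 < p.2 ∧ c (e x p.1) = c (e x p.2)).card : ℝ) * H.closedWalkWeight x := by
          rw [← sum_closedWalkWeight, Finset.mul_sum]
          exact Finset.sum_le_sum fun x _ => hwalk x
      _ = ∑ p : Fin m × Fin m with p.1 < p.2,
            ∑ x : Fin (m + 1) → V with c (e x p.1) = c (e x p.2), H.closedWalkWeight x := by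
          simp_rw [← Finset.filter_filter, ← nsmul_eq_mul, ← Finset.sum_const]
          simp_rw [Finset.sum_filter (fun x => _ = _)]
          rw [Finset.sum_comm]
      _ ≤ _ := Finset.sum_le_sum fun p hp =>
          H.sum_closedWalkWeight_filter_le hc hd hdeg (Finset.mem_filter.1 hp).2
  rw [Finset.sum_const, nsmul_eq_mul] at hsum
  have hcard : ((Finset.univ.filter fun p : Fin m × Fin m => p.1 < p.2).card : ℝ) * 2 =
      m * (2 * k + 1) := by
    have := Fin.card_filter_fst_lt_snd m
    rw [show m - 1 = 2 * k + 1 by omega] at this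
    exact_mod_cast this
  have hm0 : (0 : ℝ) < m := by rw [hm]; positivity
  set T := (H.normalizedAdjMatrix ^ (2 * k)).trace
  set T' := (H.normalizedAdjMatrix ^ m).trace
  set q := ((Finset.univ.filter fun p : Fin m × Fin m => p.1 < p.2).card : ℝ)
  refine le_of_mul_le_mul_left ?_ hm0
  calc m * (2 * ε * d * T') = 2 * d * (ε * m * T') := by ring
    _ ≤ 2 * d * (q * (d⁻¹ * T)) := by gcongr
    _ = (q * 2) * T * (d * d⁻¹) := by ring
    _ = m * ((2 * k + 1) * T) := by rw [hcard, mul_inv_cancel₀ hd.ne']; ring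

end ClosedWalks

theorem exists_closed_walk_card_colors_gt {V β : Type} [Fintype V] [DecidableEq V]
    [DecidableEq β] (H : SimpleGraph V) [DecidableRel H.Adj] {c : Sym2 V → β}
    (hc : IsProperEdgeColoring H c) {d ε : ℝ} (hε : 0 < ε)
    (hlog : 2 < Real.log (Fintype.card V)) (hd : 4 / ε * Real.log (Fintype.card V) ≤ d)
    (hdeg : ∀ u v, H.Adj u v → d ≤ H.degree u) {u v : V} (huv : H.Adj u v) :
    ∃ (v : V) (w : H.Walk v v), (1 - ε) * w.length < ((w.edges.map c).toFinset.card : ℝ) := by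
  by_contra! hcol
  set L := Real.log (Fintype.card V)
  have hd0 : 0 < d := lt_of_lt_of_le (by positivity) hd
  have hεd : 8 * L ≤ 2 * ε * d := by
    calc 8 * L = 2 * ε * (4 / ε * L) := by field_simp; ring
      _ ≤ _ := by gcongr
  let T (k : ℕ) : ℝ := (H.normalizedAdjMatrix ^ (2 * k)).trace
  have hT (k : ℕ) : 1 ≤ T k := H.one_le_trace_normalizedAdjMatrix_pow huv k
  set K := ⌈L⌉₊
  have hK1 : L ≤ K := Nat.le_ceil L
  have hK2 : (K : ℝ) < L + 1 := Nat.ceil_lt_add_one (by linarith)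
  have hstep (k : ℕ) (hk : k < K) : Real.exp 1 * T (k + 1) < T k := by
    have h1 := H.trace_le_of_forall_card_colors_le hc hd0 hdeg (k := k) hcol
    have h2 : (k : ℝ) + 1 ≤ K := by exact_mod_cast hk
    have h3 : 2 * ε * d * T (k + 1) ≤ (2 * k + 1) * T k := h1
    have h4 := hT (k + 1)
    have h5 := hT k
    have he := Real.exp_one_lt_d9
    have h6 : (2 * k + 1) * T k < (2 * L + 1) * T k := by nlinarith
    have h7 : 8 * L * T (k + 1) ≤ 2 * ε * d * T (k + 1) := by gcongr
    have h8 : (2 * L + 1) * (Real.exp 1 * T (k + 1)) ≤ 8 * L * T (k + 1) := by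
      rw [← mul_assoc]
      exact mul_le_mul_of_nonneg_right (by nlinarith) (by linarith)
    exact lt_of_mul_lt_mul_left (h8.trans_lt (h7.trans_lt (h3.trans_lt h6))) (by linarith)
  have hpow (k : ℕ) (hk : k ≤ K) : Real.exp k * T k ≤ T 0 := by
    induction k with
    | zero => simp
    | succ k ih =>
      refine le_trans ?_ (ih (by omega))
      rw [Nat.cast_succ, Real.exp_add, mul_assoc]
      gcongr
      exact (hstep k (by omega)).le
  have hK0 : 0 < K := Nat.ceil_pos.2 (by linarith)
  have hT0 : T 0 = Fintype.card V := by simp [T]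
  have h1 := hpow (K - 1) (by omega)
  have h2 := hstep (K - 1) (by omega)
  rw [Nat.sub_add_cancel hK0] at h2
  have hcardpos : (0 : ℝ) < Fintype.card V := by
    rw [← hT0]; linarith [hT 0]
  have h3 : Real.exp L = Fintype.card V := Real.exp_log hcardpos
  have h4 : Real.exp K = Real.exp (K - 1 : ℕ) * Real.exp 1 := by
    rw [← Real.exp_add, Nat.cast_sub hK0]; simp
  have h5 : Real.exp L ≤ Real.exp K := Real.exp_le_exp.2 hK1
  have h6 : Real.exp K < Real.exp (K - 1 : ℕ) * T (K - 1) := by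
    rw [h4]
    refine mul_lt_mul_of_pos_left (lt_of_le_of_lt ?_ h2) (Real.exp_pos _)
    exact le_mul_of_one_le_right (Real.exp_pos _).le (hT K)
  linarith

end SimpleGraph

/-- If `n` is sufficiently large, `0 < ε < 1/2`, and `G` is a properly edge-coloured
`n`-vertex graph with at least `(4/ε)·n·log n` edges, then for some `k` it contains a
cycle of length `k` with more than `(1-ε)·k` distinct colours. -/
theorem almost_rainbow_cycle_of_many_edges :
    ∃ N : ℕ, ∀ n : ℕ, N ≤ n → ∀ ε : ℝ, 0 < ε → ε < 1 / 2 →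
      ∀ (G : SimpleGraph (Fin n)) (β : Type) [DecidableEq β] (c : Sym2 (Fin n) → β),
        IsProperEdgeColoring G c →
        4 / ε * (n : ℝ) * Real.log n ≤ (G.edgeSet.ncard : ℝ) →
        ∃ (k : ℕ) (v : Fin n) (w : G.Walk v v), w.IsCycle ∧ w.length = k ∧
          (1 - ε) * (k : ℝ) < ((w.edges.map c).toFinset.card : ℝ) := by
  classical
  refine ⟨8, fun n hn ε hε hε' G β _ c hc hedges => ?_⟩
  suffices ∃ (v : Fin n) (w : G.Walk v v), w.IsCycle ∧
      (1 - ε) * (w.length : ℝ) < ((w.edges.map c).toFinset.card : ℝ) by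
    obtain ⟨v, w, hw, h⟩ := this
    exact ⟨_, v, w, hw, rfl, h⟩
  by_contra! hcyc
  have hlog : 2 < Real.log n := by
    have h1 : Real.log 8 ≤ Real.log n := Real.log_le_log (by norm_num) (by exact_mod_cast hn)
    have h2 : Real.log 8 = 3 * Real.log 2 := by
      rw [← Real.log_rpow (by norm_num)]; norm_num
    linarith [Real.log_two_gt_d9]
  have : Nonempty (Fin n) := ⟨⟨0, by omega⟩⟩
  have hd0 : 0 < 4 / ε * Real.log n := by positivity
  obtain ⟨S, ⟨u, hu⟩, hS⟩ := G.exists_nonempty_forall_le_card_filter (d := 4 / ε * Real.log n) (by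
    rw [Fintype.card_fin, ← Set.ncard_coe_finset, SimpleGraph.coe_edgeFinset]
    linarith)
  let H : SimpleGraph (Fin n) :=
    { Adj := fun u v => u ∈ S ∧ v ∈ S ∧ G.Adj u v
      symm := ⟨fun _ _ h => ⟨h.2.1, h.1, h.2.2.symm⟩⟩
      loopless := ⟨fun _ h => G.irrefl h.2.2⟩ }
  have hHG : H ≤ G := fun _ _ h => h.2.2
  have hdegree (v : Fin n) (hv : v ∈ S) : 4 / ε * Real.log n ≤ H.degree v := by
    refine (hS v hv).trans_eq ?_
    rw [← SimpleGraph.card_neighborFinset_eq_degree]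
    congr 2
    ext y
    simp [H, hv]
  obtain ⟨v, huv⟩ : ∃ v, H.Adj u v := by
    rw [← H.degree_pos_iff_exists_adj]
    exact_mod_cast hd0.trans_le (hdegree u hu)
  obtain ⟨v, w, hw⟩ := H.exists_closed_walk_card_colors_gt (c := c)
    (d := 4 / ε * Real.log n)
    (fun _ _ h₁ h₂ => hc (SimpleGraph.edgeSet_mono hHG h₁) (SimpleGraph.edgeSet_mono hHG h₂)) hε
    (by simpa using hlog) (by simp) (fun v y h => by simpa using hdegree v h.1) huv
  have := (w.mapLe hHG).card_colors_le_of_forall_isCycle c (t := 1 - ε) (by linarith) hcyc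
  simp at this
  linarith
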